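/- Let y : D → ℕ be a counting function with coefficients c_α and let 1 ≤ t ≤ m. Then the fraction is a (mixed) orthogonal array of strength t — i.e. for every I ⊆ {1,…,m} with #I = t the margin R_I(ζ_I) = Σ_{ζ_J ∈ D_J} y(ζ_I, ζ_J) (J = I^c) is constant on D_I — if and only if c_α = 0 for every α ∈ L with 1 ≤ wt(α) ≤ t, where wt(α) is the number of nonzero components of α. -/

import Mathlib

open scoped BigOperators Classical

/-- The interaction term `X^α` on the full factorial design, where a design
point `ζ` is coded by its exponents: the `j`-th coordinate of the point is
`exp(2πi ζ_j / n_j)`, and `X^α(ζ) = ∏_j exp(2πi α_j ζ_j / n_j)`. -/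
noncomputable def Xterm (m : ℕ) (n : Fin m → ℕ) (α ζ : ∀ j, ZMod (n j)) : ℂ :=
  ∏ j, Complex.exp (2 * (Real.pi : ℂ) * Complex.I * ((α j).val : ℂ) * ((ζ j).val : ℂ) / (n j : ℂ))

/-- The coefficient `c_α = (1/#D) Σ_{ζ∈D} y(ζ)·conj(X^α(ζ))` of the counting
function `y` of a fraction. -/
noncomputable def coeff (m : ℕ) (n : Fin m → ℕ) [∀ j, NeZero (n j)]
    (y : (∀ j, ZMod (n j)) → ℕ) (α : ∀ j, ZMod (n j)) : ℂ :=
  (∏ j, (n j : ℂ))⁻¹ * ∑ ζ : ∀ j, ZMod (n j), (y ζ : ℂ) * (starRingEnd ℂ) (Xterm m n α ζ)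

/-- Each interaction term is a product of standard additive characters. -/
lemma Xterm_eq_prod_stdAddChar (m : ℕ) (n : Fin m → ℕ) [∀ j, NeZero (n j)]
    (α ζ : ∀ j, ZMod (n j)) :
    Xterm m n α ζ = ∏ j, (ZMod.stdAddChar (α j * ζ j) : ℂ) := by
  refine Finset.prod_congr rfl fun j _ => ?_
  have h := ZMod.stdAddChar_coe (N := n j) (((α j).val : ℤ) * ((ζ j).val : ℤ))
  push_cast [ZMod.natCast_zmod_val] at h
  rw [h]
  congr 1
  ring

lemma conj_Xterm (m : ℕ) (n : Fin m → ℕ) [∀ j, NeZero (n j)] (α ζ : ∀ j, ZMod (n j)) :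
    (starRingEnd ℂ) (Xterm m n α ζ) = ∏ j, (ZMod.stdAddChar (-(α j * ζ j)) : ℂ) := by
  rw [Xterm_eq_prod_stdAddChar, map_prod]
  exact Finset.prod_congr rfl fun j _ => (AddChar.map_neg_eq_conj _ _).symm

/-- Orthogonality of the standard additive characters of `ZMod N`. -/
lemma sum_stdAddChar_mul (N : ℕ) [NeZero N] (b : ZMod N) :
    ∑ x : ZMod N, (ZMod.stdAddChar (x * b) : ℂ) = if b = 0 then (N : ℂ) else 0 := by
  rw [AddChar.sum_mulShift b (ZMod.isPrimitive_stdAddChar N), ZMod.card]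
  split_ifs <;> simp

/-- A nontrivial interaction term sums to zero over the full design. -/
lemma sum_conj_Xterm_eq_zero (m : ℕ) (n : Fin m → ℕ) [∀ j, NeZero (n j)]
    (α : ∀ j, ZMod (n j)) {i : Fin m} (hi : α i ≠ 0) :
    ∑ ζ, (starRingEnd ℂ) (Xterm m n α ζ) = 0 := by
  simp_rw [conj_Xterm]
  have h := Finset.prod_univ_sum (fun j => (Finset.univ : Finset (ZMod (n j))))
    (fun j x => (ZMod.stdAddChar (-(α j * x)) : ℂ))
  rw [Fintype.piFinset_univ] at h
  rw [← h]
  refine Finset.prod_eq_zero (Finset.mem_univ i) ?_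
  have h2 := sum_stdAddChar_mul (n i) (-α i)
  rw [if_neg (neg_ne_zero.mpr hi)] at h2
  rw [← h2]
  exact Finset.sum_congr rfl fun x _ => by congr 1; ring

/-- The indicator of agreement on `I` expands into the interaction terms supported in `I`. -/
lemma sum_Xterm_mul_conj_Xterm (m : ℕ) (n : Fin m → ℕ) [∀ j, NeZero (n j)]
    (I : Finset (Fin m)) (ζ η : ∀ j, ZMod (n j)) :
    ∑ α ∈ Finset.univ.filter (fun α : ∀ j, ZMod (n j) => ∀ j, j ∉ I → α j = 0),
        Xterm m n α ζ * (starRingEnd ℂ) (Xterm m n α η) =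
      if ∀ j ∈ I, η j = ζ j then ∏ j ∈ I, (n j : ℂ) else 0 := by
  have hset : Finset.univ.filter (fun α : ∀ j, ZMod (n j) => ∀ j, j ∉ I → α j = 0) =
      Fintype.piFinset (fun j => if j ∈ I then (Finset.univ : Finset (ZMod (n j))) else {0}) := by
    ext α
    simp only [Finset.mem_filter, Finset.mem_univ, true_and, Fintype.mem_piFinset]
    refine forall_congr' fun j => ?_
    by_cases hj : j ∈ I <;> simp [hj]
  have hterm : ∀ α, Xterm m n α ζ * (starRingEnd ℂ) (Xterm m n α η) =
      ∏ j, (ZMod.stdAddChar (α j * (ζ j - η j)) : ℂ) := fun α => by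
    rw [conj_Xterm, Xterm_eq_prod_stdAddChar, ← Finset.prod_mul_distrib]
    refine Finset.prod_congr rfl fun j _ => ?_
    rw [← AddChar.map_add_eq_mul]
    congr 1
    ring
  have hfactor : ∀ j, ∑ x ∈ (if j ∈ I then (Finset.univ : Finset (ZMod (n j))) else {0}),
      (ZMod.stdAddChar (x * (ζ j - η j)) : ℂ) =
      if j ∈ I then (if η j = ζ j then (n j : ℂ) else 0) else 1 := fun j => by
    by_cases hj : j ∈ I
    · simp [hj, sum_stdAddChar_mul, sub_eq_zero, eq_comm]
    · simp [hj]
  simp_rw [hterm]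
  rw [hset, ← Finset.prod_univ_sum (fun j => if j ∈ I then (Finset.univ : Finset (ZMod (n j)))
    else {0}) (fun j x => (ZMod.stdAddChar (x * (ζ j - η j)) : ℂ))]
  simp_rw [hfactor]
  rw [Finset.prod_ite_mem, Finset.univ_inter]
  split_ifs with h
  · exact Finset.prod_congr rfl fun j hj => if_pos (h j hj)
  · push Not at h
    obtain ⟨j, hj, hne⟩ := h
    exact Finset.prod_eq_zero hj (if_neg hne)

/-- The number of design points agreeing with `η` on `I` does not depend on `η`. -/
lemma card_filter_agree (m : ℕ) (n : Fin m → ℕ) [∀ j, NeZero (n j)]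
    (I : Finset (Fin m)) (η : ∀ j, ZMod (n j)) :
    (Finset.univ.filter (fun ζ : ∀ j, ZMod (n j) => ∀ j ∈ I, η j = ζ j)).card =
      (Finset.univ.filter (fun ζ : ∀ j, ZMod (n j) => ∀ j ∈ I, ζ j = 0)).card := by
  refine Finset.card_bij' (fun ζ _ => ζ - η) (fun ζ _ => ζ + η) ?_ ?_ ?_ ?_
  · intro ζ h
    simp only [Finset.mem_filter, Finset.mem_univ, true_and] at h ⊢
    intro j hj
    simp [h j hj]
  · intro ζ h
    simp only [Finset.mem_filter, Finset.mem_univ, true_and] at h ⊢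
    intro j hj
    simp [h j hj]
  · intros; simp
  · intros; simp

/-- If the margin of `y` on `I` is constant, every nontrivial coefficient of `y` with support
in `I` vanishes. -/
lemma coeff_eq_zero_of_margin_const (m : ℕ) (n : Fin m → ℕ) [∀ j, NeZero (n j)]
    (y : (∀ j, ZMod (n j)) → ℕ) (I : Finset (Fin m))
    (h : ∀ ζ ζ' : ∀ j, ZMod (n j),
      (∑ η ∈ Finset.univ.filter (fun η : ∀ j, ZMod (n j) => ∀ j ∈ I, η j = ζ j), y η) =
      (∑ η ∈ Finset.univ.filter (fun η : ∀ j, ZMod (n j) => ∀ j ∈ I, η j = ζ' j), y η))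
    (α : ∀ j, ZMod (n j)) (hα : ∀ j, j ∉ I → α j = 0) {i : Fin m} (hi : α i ≠ 0) :
    coeff m n y α = 0 := by
  set f : (∀ j, ZMod (n j)) → ℂ := fun ζ => (starRingEnd ℂ) (Xterm m n α ζ) with hf
  set K := (Finset.univ.filter (fun ζ : ∀ j, ZMod (n j) => ∀ j ∈ I, ζ j = 0)).card with hK
  have hK0 : (K : ℂ) ≠ 0 := by
    rw [Nat.cast_ne_zero, hK]
    exact Finset.card_ne_zero_of_mem (a := 0) (by simp)
  have hfI : ∀ ζ η, (∀ j ∈ I, η j = ζ j) → f ζ = f η := fun ζ η hζη => by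
    simp only [hf, conj_Xterm]
    refine Finset.prod_congr rfl fun j _ => ?_
    by_cases hj : j ∈ I
    · rw [hζη j hj]
    · simp [hα j hj]
  have hleft : ∑ ζ, ∑ η, (if ∀ j ∈ I, η j = ζ j then (y η : ℂ) * f ζ else 0) = 0 := by
    have hrow : ∀ ζ, ∑ η, (if ∀ j ∈ I, η j = ζ j then (y η : ℂ) * f ζ else 0) =
        ((∑ η ∈ Finset.univ.filter (fun η : ∀ j, ZMod (n j) => ∀ j ∈ I, η j = (0 : ∀ j, ZMod (n j)) j),
          y η : ℕ) : ℂ) * f ζ := fun ζ => by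
      rw [← h ζ 0, Nat.cast_sum, Finset.sum_mul, Finset.sum_filter]
    rw [Finset.sum_congr rfl fun ζ _ => hrow ζ, ← Finset.mul_sum,
      sum_conj_Xterm_eq_zero m n α hi, mul_zero]
  have hright : ∑ ζ, ∑ η, (if ∀ j ∈ I, η j = ζ j then (y η : ℂ) * f ζ else 0) =
      K * ∑ η, (y η : ℂ) * f η := by
    rw [Finset.sum_comm, Finset.mul_sum]
    refine Finset.sum_congr rfl fun η _ => ?_
    rw [← Finset.sum_filter, hK, ← card_filter_agree m n I η, ← nsmul_eq_mul]
    refine Finset.sum_eq_card_nsmul fun ζ hζ => ?_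
    rw [hfI ζ η (Finset.mem_filter.mp hζ).2]
  have hzero := (mul_eq_zero.mp (hright.symm.trans hleft)).resolve_left hK0
  rw [coeff, hzero, mul_zero]

/-- If all nontrivial coefficients of `y` with support in `I` vanish, the margin of `y` on `I` is
the constant given by the total number of points. -/
lemma prod_mul_margin_eq (m : ℕ) (n : Fin m → ℕ) [∀ j, NeZero (n j)]
    (y : (∀ j, ZMod (n j)) → ℕ) (I : Finset (Fin m))
    (h : ∀ α : ∀ j, ZMod (n j), (∀ j, j ∉ I → α j = 0) → α ≠ 0 → coeff m n y α = 0)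
    (ζ : ∀ j, ZMod (n j)) :
    (∏ j ∈ I, (n j : ℂ)) *
      ((∑ η ∈ Finset.univ.filter (fun η : ∀ j, ZMod (n j) => ∀ j ∈ I, η j = ζ j), y η : ℕ) : ℂ) =
      ∑ η, (y η : ℂ) := by
  have hsum : ∀ α : ∀ j, ZMod (n j), (∀ j, j ∉ I → α j = 0) → α ≠ 0 →
      ∑ η, (y η : ℂ) * (starRingEnd ℂ) (Xterm m n α η) = 0 := fun α hα h0 =>
    (mul_eq_zero.mp (h α hα h0)).resolve_left
      (inv_ne_zero (Finset.prod_ne_zero_iff.mpr fun j _ => Nat.cast_ne_zero.mpr (NeZero.ne _)))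
  calc _ = ∑ η, (y η : ℂ) *
        (if ∀ j ∈ I, η j = ζ j then ∏ j ∈ I, (n j : ℂ) else 0) := by
        rw [Nat.cast_sum, Finset.mul_sum, Finset.sum_filter]
        refine Finset.sum_congr rfl fun η _ => ?_
        split_ifs <;> ring
    _ = ∑ α ∈ Finset.univ.filter (fun α : ∀ j, ZMod (n j) => ∀ j, j ∉ I → α j = 0),
        Xterm m n α ζ * ∑ η, (y η : ℂ) * (starRingEnd ℂ) (Xterm m n α η) := by
        simp_rw [← sum_Xterm_mul_conj_Xterm, Finset.mul_sum]
        rw [Finset.sum_comm]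
        refine Finset.sum_congr rfl fun α _ => Finset.sum_congr rfl fun η _ => by ring
    _ = Xterm m n 0 ζ * ∑ η, (y η : ℂ) * (starRingEnd ℂ) (Xterm m n 0 η) := by
        refine Finset.sum_eq_single 0 (fun α hα h0 => ?_) (fun h0 => ?_)
        · rw [hsum α (Finset.mem_filter.mp hα).2 h0, mul_zero]
        · exact absurd (by simp) h0
    _ = ∑ η, (y η : ℂ) := by simp [Xterm]

/-- A fraction is a (mixed) orthogonal array of strength `t` — every margin on
`t` factors is constant — iff `c_α = 0` for every `α` with `1 ≤ wt(α) ≤ t`,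
where `wt(α)` is the number of nonzero components of `α`. -/
theorem orthogonal_array_iff_coeffs_zero (m : ℕ) (hm : 1 ≤ m) (n : Fin m → ℕ)
    [∀ j, NeZero (n j)] (y : (∀ j, ZMod (n j)) → ℕ) (t : ℕ) (ht1 : 1 ≤ t) (ht2 : t ≤ m) :
    (∀ I : Finset (Fin m), I.card = t →
        ∀ ζ ζ' : ∀ j, ZMod (n j),
          (∑ η ∈ Finset.univ.filter (fun η : ∀ j, ZMod (n j) => ∀ j ∈ I, η j = ζ j), y η) =
          (∑ η ∈ Finset.univ.filter (fun η : ∀ j, ZMod (n j) => ∀ j ∈ I, η j = ζ' j), y η)) ↔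
      (∀ α : ∀ j, ZMod (n j),
        1 ≤ (Finset.univ.filter (fun j => α j ≠ 0)).card →
        (Finset.univ.filter (fun j => α j ≠ 0)).card ≤ t →
        coeff m n y α = 0) := by
  constructor
  · intro h α h1 h2
    obtain ⟨I, hSI, hI⟩ := Finset.exists_superset_card_eq h2 (by simpa using ht2)
    obtain ⟨i, hi⟩ := Finset.card_pos.mp h1
    refine coeff_eq_zero_of_margin_const m n y I (h I hI) α (fun j hj => ?_)
      (Finset.mem_filter.mp hi).2
    by_contra hne
    exact hj (hSI (Finset.mem_filter.mpr ⟨Finset.mem_univ j, hne⟩))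
  · intro h I hI ζ ζ'
    have hcoeff : ∀ α : ∀ j, ZMod (n j), (∀ j, j ∉ I → α j = 0) → α ≠ 0 →
        coeff m n y α = 0 := fun α hα h0 => by
      obtain ⟨i, hi⟩ := Function.ne_iff.mp h0
      refine h α (Finset.card_pos.mpr ⟨i, Finset.mem_filter.mpr ⟨Finset.mem_univ i, hi⟩⟩) ?_
      rw [← hI]
      refine Finset.card_le_card fun j hj => ?_
      by_contra hjI
      exact (Finset.mem_filter.mp hj).2 (hα j hjI)
    have hprod : (∏ j ∈ I, (n j : ℂ)) ≠ 0 :=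
      Finset.prod_ne_zero_iff.mpr fun j _ => Nat.cast_ne_zero.mpr (NeZero.ne _)
    exact Nat.cast_injective (R := ℂ) (mul_left_cancel₀ hprod
      ((prod_mul_margin_eq m n y I hcoeff ζ).trans (prod_mul_margin_eq m n y I hcoeff ζ').symm))
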